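/- arXiv:2309.01750 — 2 statements merged into one kernel-verified Lean document; each statement's English description precedes it below -/
import Mathlib

section
/- For integers 2 ≤ k ≤ n−2, every CNF formula ucp-equivalent to Ψ_{n,k} has at least n·C(n−1, k, k−1) clauses. -/
/-- A literal on variables `x_1, …, x_n`: a variable together with a polarity
(`true` = positive literal, `false` = negative literal). -/
abbrev Lit (n : ℕ) := Fin n × Bool

/-- A clause is a finite set of literals. -/
abbrev Clause (n : ℕ) := Finset (Lit n)

/-- A CNF formula is a finite set of clauses. -/
abbrev CnfFormula (n : ℕ) := Finset (Clause n)

/-- Negation of a literal. -/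
def negLit {n : ℕ} (l : Lit n) : Lit n := (l.1, !l.2)

/-- A clause is well-formed if its literals are on pairwise distinct variables. -/
def Clause.Wf {n : ℕ} (C : Clause n) : Prop :=
  ∀ l ∈ C, ∀ l' ∈ C, l.1 = l'.1 → l = l'

/-- A partial assignment: a set of literals containing no complementary pair. -/
def IsPartialAssignment {n : ℕ} (α : Finset (Lit n)) : Prop :=
  ∀ l ∈ α, negLit l ∉ α

/-- The set of unit clauses corresponding to a set of literals. -/
def unitClauses {n : ℕ} (α : Finset (Lit n)) : CnfFormula n :=
  α.image (fun l => {l})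

/-- `UcpDeriv φ l` says that `l` lies in the least set `U` of literals closed under
the rule: if `C ∈ φ`, `l ∈ C`, and the negation of every literal of `C \ {l}`
lies in `U`, then `l ∈ U`. -/
inductive UcpDeriv {n : ℕ} (φ : CnfFormula n) : Lit n → Prop
  | step (C : Clause n) (hC : C ∈ φ) (l : Lit n) (hl : l ∈ C)
      (h : ∀ l' ∈ C.erase l, UcpDeriv φ (negLit l')) : UcpDeriv φ l

/-- The set of literals derived by unit clause propagation on `φ`. -/
def UcpSet {n : ℕ} (φ : CnfFormula n) : Set (Lit n) := {l | UcpDeriv φ l}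

/-- UCP on `φ` reaches the contradiction `⊥`: for some clause `C ∈ φ`, the negation of
every literal of `C` is derived. -/
def UcpBot {n : ℕ} (φ : CnfFormula n) : Prop :=
  ∃ C ∈ φ, ∀ l ∈ C, UcpDeriv φ (negLit l)

/-- Formulas `φ₁` and `φ₂` are ucp-equivalent: for every partial assignment `α`,
`UCP(φ₁ ∪ α) = UCP(φ₂ ∪ α)` (either both are `{⊥}`, or neither is and the derived
sets of literals coincide). -/
def UcpEquiv {n : ℕ} (φ₁ φ₂ : CnfFormula n) : Prop :=
  ∀ α : Finset (Lit n), IsPartialAssignment α →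
    (UcpBot (φ₁ ∪ unitClauses α) ↔ UcpBot (φ₂ ∪ unitClauses α)) ∧
    (¬ UcpBot (φ₁ ∪ unitClauses α) →
      UcpSet (φ₁ ∪ unitClauses α) = UcpSet (φ₂ ∪ unitClauses α))

/-- A total assignment satisfies a literal. -/
def SatLit {n : ℕ} (a : Fin n → Bool) (l : Lit n) : Prop := a l.1 = l.2

/-- A total assignment satisfies a clause if it satisfies some literal of it. -/
def SatClause {n : ℕ} (a : Fin n → Bool) (C : Clause n) : Prop := ∃ l ∈ C, SatLit a l

/-- A total assignment satisfies a formula if it satisfies every clause of it. -/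
def SatFormula {n : ℕ} (a : Fin n → Bool) (φ : CnfFormula n) : Prop :=
  ∀ C ∈ φ, SatClause a C


instance {n : ℕ} (C : Clause n) : Decidable (Clause.Wf C) :=
  decidable_of_iff (∀ l ∈ C, ∀ l' ∈ C, l.1 = l'.1 → l = l') Iff.rfl

/-- `Ψ_{n,k}`: the CNF formula on `x₁, …, xₙ` consisting of all clauses (on pairwise
distinct variables) containing exactly `k` negative literals and one positive literal. -/
def Psi (n k : ℕ) : CnfFormula n :=
  Finset.univ.filter (fun C : Clause n =>
    Clause.Wf C ∧ (C.filter (fun l => l.2 = false)).card = k ∧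
      (C.filter (fun l => l.2 = true)).card = 1)

/-- `F` is a covering system witnessing `C(n, r, k)`: a family of `r`-element subsets of an
`n`-element set such that every `k`-element subset is contained in at least one member. -/
def IsCoveringSystem (n r k : ℕ) (F : Finset (Finset (Fin n))) : Prop :=
  (∀ e ∈ F, e.card = r) ∧ ∀ s : Finset (Fin n), s.card = k → ∃ e ∈ F, s ⊆ e

/-- The covering number `C(n, r, k)`: the smallest size of a family of `r`-element subsets
of an `n`-element set such that every `k`-element subset is contained in at least one
member of the family. -/
noncomputable def coverNum (n r k : ℕ) : ℕ :=
  sInf {m | ∃ F : Finset (Finset (Fin n)), IsCoveringSystem n r k F ∧ F.card = m}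

/-- The variables occurring in the clause `C` with polarity `b`. -/
def Clause.vars {n : ℕ} (C : Clause n) (b : Bool) : Finset (Fin n) :=
  Finset.univ.filter fun v => (v, b) ∈ C

@[simp] lemma Clause.mem_vars {n : ℕ} {C : Clause n} {b : Bool} {v : Fin n} :
    v ∈ C.vars b ↔ (v, b) ∈ C := by
  simp [Clause.vars]

lemma Clause.card_filter_eq_card_vars {n : ℕ} (C : Clause n) (b : Bool) :
    (C.filter fun l => l.2 = b).card = (C.vars b).card := by
  symm
  refine Finset.card_bij (fun v _ => (v, b)) ?_ ?_ ?_
  · intro v hv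
    simpa using hv
  · intro v _ w _ h
    simpa using h
  · rintro ⟨v, c⟩ h
    simp only [Finset.mem_filter] at h
    obtain ⟨h, rfl⟩ := h
    exact ⟨v, by simpa using h, rfl⟩

lemma mem_Psi {n k : ℕ} {C : Clause n} :
    C ∈ Psi n k ↔ C.Wf ∧ (C.vars false).card = k ∧ (C.vars true).card = 1 := by
  simp [Psi, Clause.card_filter_eq_card_vars]

@[simp] lemma mem_unitClauses {n : ℕ} {α : Finset (Lit n)} {C : Clause n} :
    C ∈ unitClauses α ↔ ∃ l ∈ α, {l} = C := by
  simp [unitClauses]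

lemma UcpDeriv.of_mem {n : ℕ} {φ : CnfFormula n} {α : Finset (Lit n)} {l : Lit n}
    (hl : l ∈ α) : UcpDeriv (φ ∪ unitClauses α) l :=
  .step {l} (by simp [hl]) l (by simp) (by simp)

lemma not_satLit_of_satLit_negLit {n : ℕ} {a : Fin n → Bool} {l : Lit n}
    (h : SatLit a (negLit l)) : ¬ SatLit a l := by
  simp_all [SatLit, negLit]

/-- Unit clause propagation is sound. -/
lemma UcpDeriv.satLit {n : ℕ} {φ : CnfFormula n} {a : Fin n → Bool} (ha : SatFormula a φ)
    {l : Lit n} (h : UcpDeriv φ l) : SatLit a l := by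
  induction h with
  | step C hC l hl _ ih =>
    obtain ⟨l', hl', hs⟩ := ha C hC
    by_cases hne : l' = l
    · exact hne ▸ hs
    · exact absurd hs (not_satLit_of_satLit_negLit (ih l' (Finset.mem_erase.2 ⟨hne, hl'⟩)))

lemma SatFormula.not_ucpBot {n : ℕ} {φ : CnfFormula n} {a : Fin n → Bool}
    (ha : SatFormula a φ) : ¬ UcpBot φ := by
  rintro ⟨C, hC, h⟩
  obtain ⟨l, hl, hs⟩ := ha C hC
  exact not_satLit_of_satLit_negLit ((h l hl).satLit ha) hs

lemma SatFormula.union_unitClauses {n : ℕ} {φ : CnfFormula n} {α : Finset (Lit n)}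
    {a : Fin n → Bool} (ha : SatFormula a φ) (hα : ∀ l ∈ α, SatLit a l) :
    SatFormula a (φ ∪ unitClauses α) := by
  intro C hC
  rcases Finset.mem_union.1 hC with hC | hC
  · exact ha C hC
  · obtain ⟨l, hl, rfl⟩ := mem_unitClauses.1 hC
    exact ⟨l, by simp, hα l hl⟩

lemma satFormula_Psi_true (n k : ℕ) : SatFormula (fun _ => true) (Psi n k) := by
  intro C hC
  obtain ⟨-, -, h⟩ := mem_Psi.1 hC
  obtain ⟨v, hv⟩ := Finset.card_pos.1 (h ▸ one_pos)
  exact ⟨(v, true), Clause.mem_vars.1 hv, rfl⟩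

lemma satFormula_Psi_of_card_lt {n k : ℕ} {A : Finset (Fin n)} (hA : A.card < k) :
    SatFormula (fun v => decide (v ∈ A)) (Psi n k) := by
  intro C hC
  obtain ⟨-, h, -⟩ := mem_Psi.1 hC
  obtain ⟨v, hv, hvA⟩ := Finset.exists_mem_notMem_of_card_lt_card (h ▸ hA)
  exact ⟨(v, false), Clause.mem_vars.1 hv, by simpa [SatLit] using hvA⟩

/-- Under the negation of one of its clauses, a formula propagates to a contradiction. -/
lemma ucpBot_union_unitClauses_negLit {n : ℕ} {φ : CnfFormula n} {C : Clause n} (hC : C ∈ φ) :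
    UcpBot (φ ∪ unitClauses (C.image negLit)) :=
  ⟨C, Finset.mem_union_left _ hC, fun _ hl => .of_mem (Finset.mem_image_of_mem _ hl)⟩

lemma Clause.Wf.isPartialAssignment_negLit {n : ℕ} {C : Clause n} (hC : C.Wf) :
    IsPartialAssignment (C.image negLit) := by
  intro l hl hl'
  obtain ⟨p, hp, rfl⟩ := Finset.mem_image.1 hl
  obtain ⟨q, hq, hqp⟩ := Finset.mem_image.1 hl'
  obtain rfl := hC q hq p hp (by simpa [negLit] using congrArg Prod.fst hqp)
  simpa [negLit] using congrArg Prod.snd hqp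

lemma UcpEquiv.exists_not_satLit_negLit {n : ℕ} {φ ψ : CnfFormula n} (h : UcpEquiv φ ψ)
    {C : Clause n} (hC : C ∈ φ) (hwf : C.Wf) {a : Fin n → Bool} (ha : SatFormula a ψ) :
    ∃ l ∈ C, ¬ SatLit a (negLit l) := by
  by_contra! hcon
  refine (ha.union_unitClauses (α := C.image negLit) ?_).not_ucpBot
    ((h _ hwf.isPartialAssignment_negLit).1.1 (ucpBot_union_unitClauses_negLit hC))
  exact Finset.forall_mem_image.2 fun l hl => hcon l hl

lemma UcpEquiv.le_card_vars_false {n k : ℕ} {φ : CnfFormula n} (h : UcpEquiv φ (Psi n k))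
    {C : Clause n} (hC : C ∈ φ) (hwf : C.Wf) : k ≤ (C.vars false).card := by
  by_contra! hlt
  obtain ⟨⟨v, b⟩, hl, hs⟩ := h.exists_not_satLit_negLit hC hwf (satFormula_Psi_of_card_lt hlt)
  cases b with
  | false => exact hs (by simpa [SatLit, negLit] using hl)
  | true =>
    refine hs ?_
    have : (v, false) ∉ C := fun h' => by simpa using hwf _ hl _ h' rfl
    simpa [SatLit, negLit] using this

lemma UcpEquiv.vars_true_nonempty {n k : ℕ} {φ : CnfFormula n} (h : UcpEquiv φ (Psi n k))
    {C : Clause n} (hC : C ∈ φ) (hwf : C.Wf) : (C.vars true).Nonempty := by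
  obtain ⟨⟨v, b⟩, hl, hs⟩ := h.exists_not_satLit_negLit hC hwf (satFormula_Psi_true n k)
  cases b with
  | false => exact absurd rfl hs
  | true => exact ⟨v, by simpa using hl⟩

/-- The partial assignment making the variables of `A` true and `j` false. -/
def coverAssignment {n : ℕ} (A : Finset (Fin n)) (j : Fin n) : Finset (Lit n) :=
  insert (j, false) (A.image fun v => (v, true))

@[simp] lemma mem_coverAssignment_true {n : ℕ} {A : Finset (Fin n)} {j v : Fin n} :
    (v, true) ∈ coverAssignment A j ↔ v ∈ A := by
  simp [coverAssignment]

@[simp] lemma mem_coverAssignment_false {n : ℕ} {A : Finset (Fin n)} {j v : Fin n} :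
    (v, false) ∈ coverAssignment A j ↔ v = j := by
  simp [coverAssignment]

lemma isPartialAssignment_coverAssignment {n : ℕ} {A : Finset (Fin n)} {j : Fin n}
    (hj : j ∉ A) : IsPartialAssignment (coverAssignment A j) := by
  rintro ⟨v, b⟩ hl
  cases b
  · simp_all [negLit]
  · simp only [negLit, mem_coverAssignment_true, Bool.not_true, mem_coverAssignment_false] at hl ⊢
    rintro rfl
    exact hj hl

lemma not_ucpBot_Psi_coverAssignment {n k : ℕ} {A : Finset (Fin n)} {j : Fin n}
    (hj : j ∉ A) (hA : A.card < k) : ¬ UcpBot (Psi n k ∪ unitClauses (coverAssignment A j)) := by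
  refine ((satFormula_Psi_of_card_lt hA).union_unitClauses ?_).not_ucpBot
  rintro ⟨v, b⟩ hl
  cases b
  · simp only [mem_coverAssignment_false] at hl
    simpa [SatLit, hl] using hj
  · simpa [SatLit] using hl

lemma ucpDeriv_Psi_coverAssignment {n k : ℕ} {A : Finset (Fin n)} {i j : Fin n}
    (hj : j ∉ A) (hi : i ∉ A) (hij : i ≠ j) (hA : A.card + 1 = k) :
    UcpDeriv (Psi n k ∪ unitClauses (coverAssignment A j)) (i, false) := by
  let D : Clause n := insert (j, true) ((insert i A).image fun v => (v, false))
  have hf : ∀ v, (v, false) ∈ D ↔ v ∈ insert i A := by simp [D]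
  have ht : ∀ v, (v, true) ∈ D ↔ v = j := by simp [D]
  refine .step D (Finset.mem_union_left _ (mem_Psi.2 ⟨?_, ?_, ?_⟩)) _ ((hf i).2 (by simp)) ?_
  · rintro ⟨v, b⟩ hv ⟨w, c⟩ hw (rfl : v = w)
    cases b <;> cases c <;> simp only [hf, ht] at hv hw <;> grind
  · have : D.vars false = insert i A := by ext v; rw [Clause.mem_vars, hf]
    rw [this, Finset.card_insert_of_notMem hi, hA]
  · have : D.vars true = {j} := by ext v; rw [Clause.mem_vars, ht, Finset.mem_singleton]
    rw [this, Finset.card_singleton]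
  · rintro ⟨v, b⟩ hv
    obtain ⟨hne, hv⟩ := Finset.mem_erase.1 hv
    refine .of_mem ?_
    cases b
    · have := (hf v).1 hv
      simp only [negLit, Bool.not_false, mem_coverAssignment_true]
      grind
    · simpa [negLit] using (ht v).1 hv

lemma exists_unit_clause_of_ucpDeriv {n : ℕ} {φ : CnfFormula n} {α : Finset (Lit n)} {l : Lit n}
    (h : UcpDeriv (φ ∪ unitClauses α) l) (hl : l ∉ α) :
    ∃ C ∈ φ, ∃ l₀ ∈ C, ∀ l' ∈ C.erase l₀, negLit l' ∈ α := by
  by_contra! hcon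
  refine hl ?_
  clear hl
  induction h with
  | step C hC l hl _ ih =>
    rcases Finset.mem_union.1 hC with hC | hC
    · obtain ⟨l', hl', hn⟩ := hcon C hC l hl
      exact absurd (ih l' hl') hn
    · obtain ⟨m, hm, rfl⟩ := mem_unitClauses.1 hC
      rwa [Finset.mem_singleton.1 hl]

/-- A formula ucp-equivalent to `Ψ_{n,k}` contains, for every variable `j` and every set `A` of
`k - 1` other variables, a clause with head `j` whose body consists of `k` variables
including those of `A`. -/
lemma UcpEquiv.exists_clause_covering {n k : ℕ} (hkn : k < n) {φ : CnfFormula n}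
    (hwf : ∀ C ∈ φ, C.Wf) (h : UcpEquiv φ (Psi n k)) {A : Finset (Fin n)} {j : Fin n}
    (hj : j ∉ A) (hA : A.card + 1 = k) :
    ∃ C ∈ φ, C.vars true = {j} ∧ (C.vars false).card = k ∧ A ⊆ C.vars false := by
  obtain ⟨i, hi⟩ : ∃ i, i ∉ insert j A := by
    by_contra! hall
    have h1 : insert j A = Finset.univ := Finset.eq_univ_iff_forall.2 hall
    have h2 := Finset.card_insert_of_notMem hj
    rw [h1, Finset.card_univ, Fintype.card_fin] at h2
    omega
  simp only [Finset.mem_insert, not_or] at hi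
  have hbot := not_ucpBot_Psi_coverAssignment hj (k := k) (by omega)
  obtain ⟨hb, he⟩ := h _ (isPartialAssignment_coverAssignment hj)
  have hder : UcpDeriv (φ ∪ unitClauses (coverAssignment A j)) (i, false) :=
    (he (mt hb.1 hbot)).symm.subset (ucpDeriv_Psi_coverAssignment hj hi.2 hi.1 hA)
  obtain ⟨C, hC, ⟨v, b⟩, hl, hunit⟩ := exists_unit_clause_of_ucpDeriv hder (by simpa using hi.1)
  have hk := h.le_card_vars_false hC (hwf C hC)
  obtain ⟨w, hw⟩ := h.vars_true_nonempty hC (hwf C hC)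
  have hneg : ∀ u, (u, false) ∈ C → (u, false) ≠ (v, b) → u ∈ A := fun u hu hne => by
    simpa [negLit] using hunit _ (Finset.mem_erase.2 ⟨hne, hu⟩)
  have hpos : ∀ u, (u, true) ∈ C → (u, true) ≠ (v, b) → u = j := fun u hu hne => by
    simpa [negLit] using hunit _ (Finset.mem_erase.2 ⟨hne, hu⟩)
  cases b with
  | true =>
    have : C.vars false ⊆ A := fun u hu => hneg u (by simpa using hu) (by simp)
    have := Finset.card_le_card this
    omega
  | false =>
    have hsub : C.vars false ⊆ insert v A := fun u hu => by
      by_cases huv : u = v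
      · simp [huv]
      · exact Finset.mem_insert_of_mem (hneg u (by simpa using hu) (by simpa using huv))
    have hle := Finset.card_insert_le v A
    have heq : C.vars false = insert v A := Finset.eq_of_subset_of_card_le hsub (by omega)
    have hjt : ∀ u ∈ C.vars true, u = j := fun u hu => hpos u (by simpa using hu) (by simp)
    refine ⟨C, hC, ?_, ?_, ?_⟩
    · exact Finset.eq_singleton_iff_unique_mem.2 ⟨hjt w hw ▸ hw, hjt⟩
    · rw [heq] at hk ⊢
      omega
    · exact heq ▸ Finset.subset_insert v A

lemma coverNum_le_card {n r k : ℕ} {F : Finset (Finset (Fin n))} (hF : IsCoveringSystem n r k F) :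
    coverNum n r k ≤ F.card :=
  Nat.sInf_le ⟨F, hF, rfl⟩

lemma UcpEquiv.coverNum_le_card_filter {m k : ℕ} (hk : 0 < k) (hkn : k < m + 1)
    {φ : CnfFormula (m + 1)} (hwf : ∀ C ∈ φ, C.Wf) (h : UcpEquiv φ (Psi (m + 1) k))
    (j : Fin (m + 1)) :
    coverNum m k (k - 1) ≤
      (φ.filter fun C => C.vars true = {j} ∧ (C.vars false).card = k).card := by
  let body (C : Clause (m + 1)) : Finset (Fin m) :=
    Finset.univ.filter fun v => j.succAbove v ∈ C.vars false
  refine (coverNum_le_card (F := Finset.image body _) ⟨?_, ?_⟩).trans Finset.card_image_le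
  · simp only [Finset.mem_image, Finset.mem_filter]
    rintro _ ⟨C, ⟨hC, hj, hcard⟩, rfl⟩
    have hjC : (j, true) ∈ C := Clause.mem_vars.1 (hj ▸ Finset.mem_singleton_self j)
    have himage : (body C).map (Fin.succAboveEmb j) = C.vars false := by
      ext u
      simp only [Finset.mem_map, body, Finset.mem_filter, Finset.mem_univ, true_and,
        Fin.coe_succAboveEmb]
      refine ⟨fun ⟨v, hv, hvu⟩ => hvu ▸ hv, fun hu => ?_⟩
      have hne : u ≠ j := by
        rintro rfl
        simpa using hwf C hC _ hjC _ (Clause.mem_vars.1 hu) rfl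
      obtain ⟨v, rfl⟩ := Fin.exists_succAbove_eq hne
      exact ⟨v, hu, rfl⟩
    rw [← hcard, ← himage, Finset.card_map]
  · intro s hs
    obtain ⟨C, hC, hj, hcard, hsub⟩ := h.exists_clause_covering hkn hwf
      (A := s.map (Fin.succAboveEmb j)) (j := j) (by simp [Fin.succAbove_ne])
      (by rw [Finset.card_map]; omega)
    refine ⟨body C, Finset.mem_image_of_mem _ (Finset.mem_filter.2 ⟨hC, hj, hcard⟩), ?_⟩
    intro v hv
    exact Finset.mem_filter.2 ⟨Finset.mem_univ v, hsub (Finset.mem_map_of_mem _ hv)⟩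

/-- For integers `2 ≤ k ≤ n−2`, every CNF formula ucp-equivalent to
`Ψ_{n,k}` has at least `n · C(n−1, k, k−1)` clauses. -/
theorem lower_bound_ucpEquiv_psi {n k : ℕ} (hk : 2 ≤ k) (hkn : k + 2 ≤ n)
    (φ : CnfFormula n) (hwf : ∀ C ∈ φ, Clause.Wf C)
    (h : UcpEquiv φ (Psi n k)) :
    n * coverNum (n - 1) k (k - 1) ≤ φ.card := by
  obtain ⟨m, rfl⟩ : ∃ m, n = m + 1 := ⟨n - 1, by omega⟩
  let heads (j : Fin (m + 1)) : CnfFormula (m + 1) :=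
    φ.filter fun C => C.vars true = {j} ∧ (C.vars false).card = k
  have hdisj : Set.PairwiseDisjoint (Finset.univ : Finset (Fin (m + 1))) heads := by
    intro i _ j _ hij
    refine Finset.disjoint_left.2 fun C hi hj => hij ?_
    exact Finset.singleton_injective
      ((Finset.mem_filter.1 hi).2.1.symm.trans (Finset.mem_filter.1 hj).2.1)
  calc (m + 1) * coverNum (m + 1 - 1) k (k - 1)
      = ∑ _j : Fin (m + 1), coverNum m k (k - 1) := by simp
    _ ≤ ∑ j, (heads j).card :=
        Finset.sum_le_sum fun j _ => h.coverNum_le_card_filter (by omega) (by omega) hwf j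
    _ = (Finset.univ.biUnion heads).card := (Finset.card_biUnion hdisj).symm
    _ ≤ φ.card := Finset.card_le_card (Finset.biUnion_subset.2 fun _ _ => Finset.filter_subset _ _)
end

section
/- If H is a (k+1)-uniform hypergraph on the variable set X (with 1 ≤ k ≤ n−1), then the hypergraph formula θ(H) is ucp-equivalent to Ψ_{n,k} if and only if H has connected restrictions. -/
/-- `neg(A)`: the set of negative literals on the variables in `A`. -/
def negVars {n : ℕ} (A : Finset (Fin n)) : Finset (Lit n) := A.image (fun x => (x, false))

/-- The set of positive literals on the variables in `A`. -/
def posVars {n : ℕ} (A : Finset (Fin n)) : Finset (Lit n) := A.image (fun x => (x, true))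

/-- The directed graph `G^d(φ, A)` on `X ∖ A`: directed edge `(x_i, x_j)` whenever
`neg(A) ∪ {¬x_i, x_j} ∈ φ`. -/
def GdEdge {n : ℕ} (φ : CnfFormula n) (A : Finset (Fin n)) (i j : Fin n) : Prop :=
  insert ((i, false) : Lit n) (insert ((j, true) : Lit n) (negVars A)) ∈ φ

/-- The hypergraph formula `θ(H)`: the clauses `neg(e ∖ {x}) ∪ {x}` for all hyperedges
`e ∈ H` and all variables `x ∈ e`. -/
def theta {n : ℕ} (H : Finset (Finset (Fin n))) : CnfFormula n :=
  H.biUnion (fun e => e.image (fun x => insert ((x, true) : Lit n) (negVars (e.erase x))))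

/-- The edge relation of the graph `G(H, A)` on the vertex set `X ∖ A`: its edges are the
`2`-element sets `e ∖ A` for hyperedges `e ∈ H` with `A ⊆ e`. -/
def GEdge {n : ℕ} (H : Finset (Finset (Fin n))) (A : Finset (Fin n)) (u v : Fin n) : Prop :=
  u ≠ v ∧ ∃ e ∈ H, A ⊆ e ∧ e \ A = {u, v}

/-- A `(k+1)`-uniform hypergraph `H` has connected restrictions if for every
`(k−1)`-element set `A ⊆ X`, the graph `G(H, A)` is connected on the vertex set `X ∖ A`. -/
def ConnectedRestrictions {n : ℕ} (k : ℕ) (H : Finset (Finset (Fin n))) : Prop :=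
  ∀ A : Finset (Fin n), A.card + 1 = k →
    ∀ u ∉ A, ∀ v ∉ A, Relation.ReflTransGen (GEdge H A) u v

@[simp] lemma mem_negVars {n : ℕ} {A : Finset (Fin n)} {l : Lit n} :
    l ∈ negVars A ↔ l.1 ∈ A ∧ l.2 = false := by
  obtain ⟨y, b⟩ := l
  cases b <;> simp [negVars]

lemma mem_theta {n : ℕ} {H : Finset (Finset (Fin n))} {C : Clause n} :
    C ∈ theta H ↔ ∃ e ∈ H, ∃ x ∈ e, insert ((x, true) : Lit n) (negVars (e.erase x)) = C := by
  simp [theta]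

lemma insert_negVars_mem_Psi {n k : ℕ} {B : Finset (Fin n)} {x : Fin n} (hx : x ∉ B)
    (hB : B.card = k) : insert ((x, true) : Lit n) (negVars B) ∈ Psi n k := by
  have hneg : (insert ((x, true) : Lit n) (negVars B)).filter (fun l => l.2 = false)
      = negVars B := by
    ext ⟨y, b⟩
    cases b <;> simp
  have hpos : (insert ((x, true) : Lit n) (negVars B)).filter (fun l => l.2 = true)
      = {(x, true)} := by
    ext ⟨y, b⟩
    cases b <;> simp
  simp only [Psi, Finset.mem_filter, Finset.mem_univ, true_and, hneg, hpos, Finset.card_singleton,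
    and_true]
  refine ⟨?_, ?_⟩
  · rintro ⟨y, b⟩ hy ⟨z, c⟩ hz rfl
    cases b <;> cases c <;> simp_all
  · rw [negVars, Finset.card_image_of_injective _ (fun a b h => by simpa using h), hB]

lemma exists_of_mem_Psi {n k : ℕ} {C : Clause n} (hC : C ∈ Psi n k) :
    ∃ B : Finset (Fin n), ∃ x ∉ B, B.card = k ∧ insert ((x, true) : Lit n) (negVars B) = C := by
  simp only [Psi, Finset.mem_filter, Finset.mem_univ, true_and] at hC
  obtain ⟨hwf, hneg, hpos⟩ := hC
  obtain ⟨⟨x, b⟩, hx⟩ := Finset.card_eq_one.mp hpos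
  have hmem : ((x, b) : Lit n) ∈ C ∧ b = true := by
    have h := Finset.mem_singleton_self ((x, b) : Lit n)
    rw [← hx] at h
    simpa using h
  obtain ⟨hxC, rfl⟩ := hmem
  have himage : ∀ y, y ∈ (C.filter (fun l => l.2 = false)).image Prod.fst ↔ (y, false) ∈ C := by
    simp
  refine ⟨(C.filter (fun l => l.2 = false)).image Prod.fst, x, ?_, ?_, ?_⟩
  · rw [himage]
    intro h
    simpa using hwf _ h _ hxC rfl
  · rw [Finset.card_image_of_injOn, hneg]
    intro l hl l' hl' h
    simp only [Finset.coe_filter, Set.mem_ofPred_eq] at hl hl'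
    exact hwf _ hl.1 _ hl'.1 h
  · ext ⟨y, b⟩
    cases b with
    | false => simp
    | true =>
      have h := Finset.ext_iff.mp hx (y, true)
      simp only [Finset.mem_filter, Finset.mem_singleton, and_true] at h
      simp [h]

lemma theta_subset_Psi {n k : ℕ} {H : Finset (Finset (Fin n))}
    (hH : ∀ e ∈ H, e.card = k + 1) : theta H ⊆ Psi n k := by
  intro C hC
  obtain ⟨e, he, x, hx, rfl⟩ := mem_theta.mp hC
  refine insert_negVars_mem_Psi (Finset.notMem_erase x e) ?_
  rw [Finset.card_erase_of_mem hx, hH e he, Nat.add_sub_cancel]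

lemma UcpDeriv.mono {n : ℕ} {φ ψ : CnfFormula n} (h : φ ⊆ ψ) {l : Lit n} (hl : UcpDeriv φ l) :
    UcpDeriv ψ l := by
  induction hl with
  | step C hC l hl _ ih => exact .step C (h hC) l hl ih

/-- Deriving a complementary pair of literals falsifies the clause that gave one of them. -/
lemma UcpDeriv.ucpBot {n : ℕ} {φ : CnfFormula n} {l : Lit n} (h : UcpDeriv φ l)
    (h' : UcpDeriv φ (negLit l)) : UcpBot φ := by
  obtain ⟨C, hC, _, hl, hrest⟩ := h
  refine ⟨C, hC, fun m hm => ?_⟩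
  by_cases hml : m = l
  · exact hml ▸ h'
  · exact hrest m (Finset.mem_erase.mpr ⟨hml, hm⟩)

lemma GEdge.symm {n : ℕ} {H : Finset (Finset (Fin n))} {A : Finset (Fin n)} {u v : Fin n}
    (h : GEdge H A u v) : GEdge H A v u := by
  obtain ⟨hne, e, he, hA, huv⟩ := h
  exact ⟨hne.symm, e, he, hA, by rw [huv, Finset.pair_comm]⟩

lemma GEdge.insert_mem_theta {n : ℕ} {H : Finset (Finset (Fin n))} {A : Finset (Fin n)}
    {u v : Fin n} (h : GEdge H A u v) :
    insert ((v, true) : Lit n) (negVars (insert u A)) ∈ theta H := by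
  obtain ⟨hne, e, he, hA, huv⟩ := h
  have hdiff : ∀ y, (y ∈ e ∧ y ∉ A) ↔ y = u ∨ y = v := by
    simpa using Finset.ext_iff.mp huv
  refine mem_theta.mpr ⟨e, he, v, ((hdiff v).mpr (.inr rfl)).1, ?_⟩
  have herase : e.erase v = insert u A := by
    ext y
    simp only [Finset.mem_erase, Finset.mem_insert]
    have h1 := hdiff y
    have h2 := (hdiff v).mpr (.inr rfl)
    have h3 := @hA y
    constructor
    · tauto
    · rintro (rfl | hy)
      · tauto
      · exact ⟨fun h => h2.2 (h ▸ hy), h3 hy⟩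
  rw [herase]

section Propagation

variable {n : ℕ} {H : Finset (Finset (Fin n))} {φ : CnfFormula n} {A : Finset (Fin n)}
  {u v : Fin n}

lemma UcpDeriv.pos_of_reachable (hφ : theta H ⊆ φ) (hA : ∀ a ∈ A, UcpDeriv φ (a, true))
    (huv : Relation.ReflTransGen (GEdge H A) u v) (hu : UcpDeriv φ (u, true)) :
    UcpDeriv φ (v, true) := by
  induction huv with
  | refl => exact hu
  | @tail b c _ hbc ih =>
    refine .step _ (hφ hbc.insert_mem_theta) _ (Finset.mem_insert_self _ _) ?_
    rintro ⟨y, p⟩ hy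
    cases p <;> simp at hy
    rcases hy with rfl | hy
    · exact ih
    · exact hA y hy

lemma UcpDeriv.neg_of_reachable (hφ : theta H ⊆ φ) (hA : ∀ a ∈ A, UcpDeriv φ (a, true))
    (huv : Relation.ReflTransGen (GEdge H A) u v) (hu : UcpDeriv φ (u, false)) :
    UcpDeriv φ (v, false) := by
  induction huv with
  | refl => exact hu
  | @tail b c _ hbc ih =>
    refine .step _ (hφ hbc.symm.insert_mem_theta) (c, false) (by simp) ?_
    rintro ⟨y, p⟩ hy
    cases p <;> simp at hy
    · exact hA y (hy.2.resolve_left hy.1)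
    · exact hy ▸ ih

end Propagation

section Connected

variable {n k : ℕ} {H : Finset (Finset (Fin n))} {φ : CnfFormula n}

lemma ConnectedRestrictions.deriv_pos (hk : 1 ≤ k) (hconn : ConnectedRestrictions k H)
    (hφ : theta H ⊆ φ) {B : Finset (Fin n)} {x : Fin n} (hx : x ∉ B) (hB : B.card = k)
    (hd : ∀ b ∈ B, UcpDeriv φ (b, true)) : UcpDeriv φ (x, true) := by
  obtain ⟨u, hu⟩ := Finset.card_pos.mp (by omega : 0 < B.card)
  refine UcpDeriv.pos_of_reachable (A := B.erase u) hφ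
    (fun a ha => hd a (Finset.mem_of_mem_erase ha)) ?_ (hd u hu)
  exact hconn _ (by rw [Finset.card_erase_add_one hu, hB]) _ (Finset.notMem_erase u B) _
    (fun h => hx (Finset.mem_of_mem_erase h))

lemma ConnectedRestrictions.deriv_neg (hconn : ConnectedRestrictions k H)
    (hφ : theta H ⊆ φ) {B : Finset (Fin n)} {x b : Fin n} (hx : x ∉ B) (hB : B.card = k)
    (hb : b ∈ B) (hd : ∀ a ∈ B.erase b, UcpDeriv φ (a, true)) (hdx : UcpDeriv φ (x, false)) :
    UcpDeriv φ (b, false) :=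
  UcpDeriv.neg_of_reachable hφ hd
    (hconn _ (by rw [Finset.card_erase_add_one hb, hB]) _
      (fun h => hx (Finset.mem_of_mem_erase h)) _ (Finset.notMem_erase b B)) hdx

lemma ConnectedRestrictions.ucpDeriv_of_Psi (hk : 1 ≤ k) (hconn : ConnectedRestrictions k H)
    {ψ : CnfFormula n} {l : Lit n} (hl : UcpDeriv (Psi n k ∪ ψ) l) :
    UcpDeriv (theta H ∪ ψ) l := by
  induction hl with
  | step C hC l hl _ ih =>
    rcases Finset.mem_union.mp hC with hC | hC
    · obtain ⟨B, x, hx, hB, rfl⟩ := exists_of_mem_Psi hC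
      rcases Finset.mem_insert.mp hl with rfl | hl'
      · exact hconn.deriv_pos hk Finset.subset_union_left hx hB
          fun b hb => ih (b, false) (by simp [hb])
      · obtain ⟨b, p⟩ := l
        obtain ⟨hb, rfl⟩ := mem_negVars.mp hl'
        exact hconn.deriv_neg Finset.subset_union_left hx hB hb
          (fun a ha => ih (a, false) (by simpa using ha)) (ih (x, true) (by simp))
    · exact .step C (Finset.mem_union_right _ hC) l hl ih

/-- Connected restrictions make the hypergraph formula ucp-equivalent to `Ψ_{n,k}`. -/
lemma ConnectedRestrictions.ucpEquiv (hk : 1 ≤ k) (hH : ∀ e ∈ H, e.card = k + 1)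
    (hconn : ConnectedRestrictions k H) : UcpEquiv (theta H) (Psi n k) := by
  intro α _
  have hsub : theta H ∪ unitClauses α ⊆ Psi n k ∪ unitClauses α :=
    Finset.union_subset_union_left (theta_subset_Psi hH)
  refine ⟨⟨?_, ?_⟩, fun _ => Set.ext fun l =>
    ⟨fun h => h.mono hsub, fun h => hconn.ucpDeriv_of_Psi hk h⟩⟩
  · rintro ⟨C, hC, h⟩
    exact ⟨C, hsub hC, fun l hl => (h l hl).mono hsub⟩
  · rintro ⟨C, hC, h⟩
    have h' := fun l hl => hconn.ucpDeriv_of_Psi hk (h l hl)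
    rcases Finset.mem_union.mp hC with hC | hC
    · obtain ⟨B, x, hx, hB, rfl⟩ := exists_of_mem_Psi hC
      refine UcpDeriv.ucpBot (l := (x, true)) ?_ (h' (x, true) (by simp))
      exact hconn.deriv_pos hk Finset.subset_union_left hx hB
        fun b hb => h' (b, false) (by simp [hb])
    · exact ⟨C, Finset.mem_union_right _ hC, h'⟩

end Connected

section Separation

variable {n k : ℕ} {H : Finset (Finset (Fin n))} {A : Finset (Fin n)} {u : Fin n}

lemma not_mem_of_reachable (hu : u ∉ A) {v : Fin n}
    (h : Relation.ReflTransGen (GEdge H A) u v) : v ∉ A := by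
  induction h with
  | refl => exact hu
  | @tail b c _ hbc _ =>
    obtain ⟨-, e, -, -, huv⟩ := hbc
    have hc : c ∈ e \ A := by simp [huv]
    exact (Finset.mem_sdiff.mp hc).2

/-- Propagating `A` positively and `u` negatively through `θ(H)` only reaches negative literals
in the component of `u` in `G(H, A)`. -/
lemma ucpDeriv_theta_invariant (hH : ∀ e ∈ H, e.card = k + 1) (hA : A.card + 1 = k) {l : Lit n}
    (hl : UcpDeriv (theta H ∪ unitClauses (insert (u, false) (posVars A))) l) :
    (l.2 = true → l.1 ∈ A) ∧
      (l.2 = false → Relation.ReflTransGen (GEdge H A) u l.1) := by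
  induction hl with
  | step C hC l hl _ ih =>
    rcases Finset.mem_union.mp hC with hC | hC
    · obtain ⟨e, he, x, hx, rfl⟩ := mem_theta.mp hC
      have hcard := Finset.card_erase_add_one hx
      rw [hH e he] at hcard
      obtain ⟨b, p⟩ := l
      cases p with
      | true =>
        have hsub : e.erase x ⊆ A := fun y hy => (ih (y, false) (by simpa using hy)).1 rfl
        have := Finset.card_le_card hsub
        omega
      | false =>
        simp only [Finset.mem_insert, mem_negVars, Prod.mk.injEq, Bool.false_eq_true, and_false,
          false_or, and_true] at hl
        have hsub : (e.erase x).erase b ⊆ A := fun y hy =>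
          (ih (y, false) (by simpa using hy)).1 rfl
        have heq : (e.erase x).erase b = A :=
          Finset.eq_of_subset_of_card_le hsub (by
            have := Finset.card_erase_add_one hl
            omega)
        have hux : Relation.ReflTransGen (GEdge H A) u x := (ih (x, true) (by simp)).2 rfl
        have hbx := Finset.mem_erase.mp hl
        refine ⟨by simp, fun _ => hux.tail ⟨hbx.1.symm, e, he, ?_, ?_⟩⟩
        · rw [← heq]
          exact (Finset.erase_subset _ _).trans (Finset.erase_subset _ _)
        · rw [← heq]
          ext y
          simp only [Finset.mem_sdiff, Finset.mem_erase, Finset.mem_insert, Finset.mem_singleton]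
          constructor
          · tauto
          · rintro (rfl | rfl) <;> tauto
    · obtain ⟨m, hm, rfl⟩ := Finset.mem_image.mp hC
      obtain rfl := Finset.mem_singleton.mp hl
      rcases Finset.mem_insert.mp hm with rfl | hm
      · exact ⟨by simp, fun _ => .refl⟩
      · obtain ⟨a, ha, rfl⟩ := Finset.mem_image.mp hm
        exact ⟨fun _ => ha, by simp⟩

lemma not_ucpBot_theta (hH : ∀ e ∈ H, e.card = k + 1) (hA : A.card + 1 = k) (hu : u ∉ A) :
    ¬ UcpBot (theta H ∪ unitClauses (insert (u, false) (posVars A))) := by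
  rintro ⟨C, hC, h⟩
  have hinv := fun l hl => ucpDeriv_theta_invariant hH hA (h l hl)
  rcases Finset.mem_union.mp hC with hC | hC
  · obtain ⟨e, he, x, hx, rfl⟩ := mem_theta.mp hC
    have hcard := Finset.card_erase_add_one hx
    rw [hH e he] at hcard
    have hsub : e.erase x ⊆ A := fun y hy =>
      (hinv (y, false) (by simpa using Finset.mem_erase.mp hy)).1 rfl
    have := Finset.card_le_card hsub
    omega
  · obtain ⟨m, hm, rfl⟩ := Finset.mem_image.mp hC
    have hm' := hinv m (Finset.mem_singleton_self m)
    rcases Finset.mem_insert.mp hm with rfl | hm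
    · exact hu (hm'.1 rfl)
    · obtain ⟨a, ha, rfl⟩ := Finset.mem_image.mp hm
      exact not_mem_of_reachable hu (hm'.2 rfl) ha

/-- Ucp-equivalence with `Ψ_{n,k}` forces connected restrictions. -/
lemma UcpEquiv.connectedRestrictions (hH : ∀ e ∈ H, e.card = k + 1)
    (hequiv : UcpEquiv (theta H) (Psi n k)) : ConnectedRestrictions k H := by
  intro A hA u hu v hv
  by_cases huv : u = v
  · exact huv ▸ .refl
  have hα : IsPartialAssignment (insert ((u, false) : Lit n) (posVars A)) := by
    rintro ⟨y, p⟩ hy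
    cases p <;> simp_all [posVars, negLit]
    rintro rfl
    exact hu hy
  have hset := (hequiv _ hα).2 (not_ucpBot_theta hH hA hu)
  have hunit : ∀ l ∈ insert ((u, false) : Lit n) (posVars A),
      UcpDeriv (Psi n k ∪ unitClauses (insert (u, false) (posVars A))) l := fun l hl =>
    .step {l} (Finset.mem_union_right _ (Finset.mem_image_of_mem _ hl)) l
      (Finset.mem_singleton_self l) (by simp)
  have hmem : ((v, false) : Lit n) ∈
      UcpSet (Psi n k ∪ unitClauses (insert (u, false) (posVars A))) := by
    refine UcpDeriv.step (insert (u, true) (negVars (insert v A)))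
      (Finset.mem_union_left _ (insert_negVars_mem_Psi (by simp [huv, hu])
        (by rw [Finset.card_insert_of_notMem hv, hA]))) _ (by simp) ?_
    rintro ⟨y, p⟩ hy
    refine hunit _ ?_
    cases p <;> simp at hy
    · simpa [negLit, posVars] using hy.2.resolve_left hy.1
    · simp [negLit, hy]
  rw [← hset] at hmem
  exact (ucpDeriv_theta_invariant hH hA hmem).2 rfl

end Separation

/-- If `H` is a `(k+1)`-uniform hypergraph on the variable set `X`
(with `1 ≤ k ≤ n−1`), then the hypergraph formula `θ(H)` is ucp-equivalent to `Ψ_{n,k}`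
if and only if `H` has connected restrictions. -/
theorem theta_ucpEquiv_iff_connectedRestrictions {n k : ℕ} (hk : 1 ≤ k) (hkn : k + 1 ≤ n)
    (H : Finset (Finset (Fin n))) (hH : ∀ e ∈ H, e.card = k + 1) :
    UcpEquiv (theta H) (Psi n k) ↔ ConnectedRestrictions k H := by
  exact ⟨fun h => h.connectedRestrictions hH, fun h => h.ucpEquiv hk hH⟩
end
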